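/- For the complete TSP QUBO Hamiltonian H = H_A + H_B on n cities, where H_A is the permutation-matrix penalty with coefficient A, and H_B = B·Σ_{i≠j} C_{ij}·Σ_v x_{i,v}·x_{j,v+1} (indices of v taken cyclically) with B = 1, C_{ij} ≥ 0, if A > n·max_{i,j} C_{ij} then every global minimizer of H over all binary assignments x is a permutation matrix (i.e., encodes a valid tour). -/

import Mathlib

/-- Real value of a binary (Bool) variable. -/
def bval (b : Bool) : ℝ := if b then 1 else 0

/-- The permutation-matrix penalty term of the TSP QUBO. -/
def HA (n : ℕ) (A : ℝ) (x : Fin n × Fin n → Bool) : ℝ :=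
  A * ((∑ j : Fin n, (1 - ∑ v : Fin n, bval (x (j, v)))^2) +
       (∑ v : Fin n, (1 - ∑ j : Fin n, bval (x (j, v)))^2))

/-- The tour-cost term of the TSP QUBO (with `B = 1`, cyclic successor `v + 1`). -/
def HB (n : ℕ) [NeZero n] (C : Fin n → Fin n → ℝ) (x : Fin n × Fin n → Bool) : ℝ :=
  ∑ i : Fin n, ∑ j : Fin n,
    if i ≠ j then C i j * ∑ v : Fin n, bval (x (i, v)) * bval (x (j, v + 1)) else 0

lemma bval_nonneg (b : Bool) : 0 ≤ bval b := by
  unfold bval; split <;> simp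

lemma sum_bval_eq_card {ι : Type*} [Fintype ι] (f : ι → Bool) :
    ∑ i, bval (f i) = ((Finset.univ.filter fun i => f i = true).card : ℝ) := by
  simp [bval]

/-- A one-hot penalty below `1` forces exactly one variable to be set. -/
lemma existsUnique_of_sq_one_sub_sum_lt_one {ι : Type*} [Fintype ι] (f : ι → Bool)
    (h : (1 - ∑ i, bval (f i)) ^ 2 < 1) : ∃! i, f i = true := by
  rw [sum_bval_eq_card, sq_lt_one_iff_abs_lt_one, abs_lt] at h
  obtain ⟨h1, h2⟩ := h
  have hlt : (Finset.univ.filter fun i => f i = true).card < 2 := by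
    have : ((Finset.univ.filter fun i => f i = true).card : ℝ) < (2 : ℕ) := by
      push_cast; linarith
    exact_mod_cast this
  have hpos : 0 < (Finset.univ.filter fun i => f i = true).card := by
    have : (0 : ℝ) < ((Finset.univ.filter fun i => f i = true).card : ℝ) := by linarith
    exact_mod_cast this
  have hone : (Finset.univ.filter fun i => f i = true).card = 1 := by omega
  obtain ⟨a, ha⟩ := Finset.card_eq_one.mp hone
  have key : ∀ i, f i = true ↔ i = a := fun i => by
    simpa using Finset.ext_iff.mp ha i
  exact ⟨a, (key a).mpr rfl, fun i hi => (key i).mp hi⟩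

lemma HB_nonneg (n : ℕ) [NeZero n] (C : Fin n → Fin n → ℝ) (hC : ∀ i j, 0 ≤ C i j)
    (x : Fin n × Fin n → Bool) : 0 ≤ HB n C x := by
  refine Finset.sum_nonneg fun i _ => Finset.sum_nonneg fun j _ => ?_
  split_ifs
  · exact mul_nonneg (hC i j)
      (Finset.sum_nonneg fun v _ => mul_nonneg (bval_nonneg _) (bval_nonneg _))
  · exact le_rfl

lemma HA_identity_tour (n : ℕ) (A : ℝ) : HA n A (fun p => decide (p.1 = p.2)) = 0 := by
  simp [HA, bval]

lemma HB_identity_tour_le (n : ℕ) [NeZero n] (C : Fin n → Fin n → ℝ) (M : ℝ) (hM : 0 ≤ M)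
    (hCM : ∀ i j, C i j ≤ M) : HB n C (fun p => decide (p.1 = p.2)) ≤ n * M := by
  calc HB n C (fun p => decide (p.1 = p.2))
      ≤ ∑ i : Fin n, ∑ j : Fin n, if j = i + 1 then M else 0 := by
        refine Finset.sum_le_sum fun i _ => Finset.sum_le_sum fun j _ => ?_
        have hsum : ∑ v : Fin n, bval (decide (i = v)) * bval (decide (j = v + 1))
            = if j = i + 1 then 1 else 0 := by
          simp only [bval, decide_eq_true_eq, ite_mul, one_mul, zero_mul, Finset.sum_ite_eq,
            Finset.mem_univ, if_true]
        simp only [hsum]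
        have := hCM i j
        split_ifs <;> simp [this, hM]
    _ = n * M := by simp

/-- If the penalty weight exceeds `n` times the largest cost, then every global minimizer of the
TSP QUBO Hamiltonian is a permutation matrix. -/
theorem stmt_1 (n : ℕ) [NeZero n] (hn : 2 ≤ n) (C : Fin n → Fin n → ℝ)
    (hC : ∀ i j, 0 ≤ C i j) (A : ℝ)
    (hA : A > n * Finset.univ.sup'
      (Finset.univ_nonempty_iff.mpr ⟨(⟨0, by omega⟩, ⟨0, by omega⟩)⟩)
      (fun p : Fin n × Fin n => C p.1 p.2))
    (x : Fin n × Fin n → Bool)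
    (hmin : ∀ y : Fin n × Fin n → Bool, HA n A x + HB n C x ≤ HA n A y + HB n C y) :
    ∃ σ : Equiv.Perm (Fin n), ∀ j v : Fin n, x (j, v) = true ↔ σ v = j := by
  set M := Finset.univ.sup'
      (Finset.univ_nonempty_iff.mpr ⟨(⟨0, by omega⟩, ⟨0, by omega⟩)⟩)
      (fun p : Fin n × Fin n => C p.1 p.2) with hMdef
  have hCM : ∀ i j, C i j ≤ M := fun i j =>
    Finset.le_sup' (fun p : Fin n × Fin n => C p.1 p.2) (Finset.mem_univ (i, j))
  have hM : 0 ≤ M := (hC 0 0).trans (hCM 0 0)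
  have hApos : 0 < A := lt_of_le_of_lt (by positivity) hA
  have hlt : HA n A x < A := by
    have h1 := hmin fun p => decide (p.1 = p.2)
    have h2 := HA_identity_tour n A
    have h3 := HB_identity_tour_le n C M hM hCM
    have h4 := HB_nonneg n C hC x
    linarith
  have hpen : (∑ j : Fin n, (1 - ∑ v : Fin n, bval (x (j, v)))^2) +
      (∑ v : Fin n, (1 - ∑ j : Fin n, bval (x (j, v)))^2) < 1 := by
    unfold HA at hlt
    exact (mul_lt_iff_lt_one_right hApos).mp hlt
  have hrows : 0 ≤ ∑ j : Fin n, (1 - ∑ v : Fin n, bval (x (j, v)))^2 :=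
    Finset.sum_nonneg fun _ _ => sq_nonneg _
  have hcols : 0 ≤ ∑ v : Fin n, (1 - ∑ j : Fin n, bval (x (j, v)))^2 :=
    Finset.sum_nonneg fun _ _ => sq_nonneg _
  have hrow : ∀ j, ∃! v, x (j, v) = true := fun j => by
    refine existsUnique_of_sq_one_sub_sum_lt_one (fun v => x (j, v)) ?_
    have := Finset.single_le_sum (f := fun j : Fin n => (1 - ∑ v : Fin n, bval (x (j, v)))^2)
      (fun _ _ => sq_nonneg _) (Finset.mem_univ j)
    linarith
  have hcol : ∀ v, ∃! j, x (j, v) = true := fun v => by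
    refine existsUnique_of_sq_one_sub_sum_lt_one (fun j => x (j, v)) ?_
    have := Finset.single_le_sum (f := fun v : Fin n => (1 - ∑ j : Fin n, bval (x (j, v)))^2)
      (fun _ _ => sq_nonneg _) (Finset.mem_univ v)
    linarith
  choose s hs hs' using hcol
  choose r hr hr' using hrow
  refine ⟨⟨s, r, fun v => (hr' _ _ (hs v)).symm, fun j => (hs' _ _ (hr j)).symm⟩, fun j v => ?_⟩
  exact ⟨fun h => (hs' v j h).symm, fun h => h ▸ hs v⟩
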